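/- The function g : [0,∞) → ℝ given by g(T) = I(X₁,X₂,X₃,X₄; Y₅,Y₆,Y₇,Y₈,Y₉,Y₁₀), where the times are set to T₅ = T₆ = T₇ = T₈ = T₉ = T₁₀ = T/6 and all other times are 0, is concave on [0,∞). -/

import Mathlib

open MeasureTheory ProbabilityTheory Real Filter

noncomputable section

/-- Shannon entropy of a measure: the sum of `-q * log q` over the normalized
masses of singletons (Mathlib-style `measureEntropy`). -/
def measureEntropy {S : Type*} [MeasurableSpace S] (μ : Measure S) : ℝ :=
  ∑' s, Real.negMulLog (((μ Set.univ)⁻¹ • μ) {s}).toReal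

/-- Mutual information of a joint law on a product space:
`I(X;Y) = H(X) + H(Y) - H(X,Y)`. -/
def measureMutualInfo {S U : Type*} [MeasurableSpace S] [MeasurableSpace U]
    (μ : Measure (S × U)) : ℝ :=
  measureEntropy (μ.map Prod.fst) + measureEntropy (μ.map Prod.snd) - measureEntropy μ

/-- The 15 nonempty subsets of `{1,2,3,4}` (coded as `Fin 4`), in the paper's order:
`S₁={1}, S₂={2}, S₃={3}, S₄={4}, S₅={1,2}, S₆={1,3}, S₇={1,4}, S₈={2,3}, S₉={2,4},
S₁₀={3,4}, S₁₁={1,2,3}, S₁₂={1,2,4}, S₁₃={1,3,4}, S₁₄={2,3,4}, S₁₅={1,2,3,4}`. -/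
def sens : Fin 15 → Finset (Fin 4) :=
  ![{0}, {1}, {2}, {3}, {0,1}, {0,2}, {0,3}, {1,2}, {1,3}, {2,3},
    {0,1,2}, {0,1,3}, {0,2,3}, {1,2,3}, {0,1,2,3}]

/-- Law of one input component: `λ₁` with probability `p`, `λ₀` with probability `1-p`. -/
def inputLaw (p lam0 lam1 : ℝ) : Measure ℝ :=
  ENNReal.ofReal p • Measure.dirac lam1 + ENNReal.ofReal (1 - p) • Measure.dirac lam0

/-- Law of the input vector `X = (X₁,X₂,X₃,X₄)` with i.i.d. components. -/
def XLaw (p lam0 lam1 : ℝ) : Measure (Fin 4 → ℝ) :=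
  Measure.pi fun _ => inputLaw p lam0 lam1

/-- Poisson distribution on `ℕ` with (nonnegative) real rate `r`;
rate `0` gives the Dirac mass at `0`. -/
def poissonMeasure (r : ℝ) : Measure ℕ :=
  (poissonPMF r.toNNReal).toMeasure

/-- Joint law of `(X, (Y_{idx 1}, …, Y_{idx k}))` in the vector Poisson channel:
conditionally on `X = x`, the indicated outputs are independent with
`Y_i ~ Poisson (T i * ∑_{j ∈ Sᵢ} x j)`. -/
def poissonJointLaw (p lam0 lam1 : ℝ) (T : Fin 15 → ℝ) {k : ℕ} (idx : Fin k → Fin 15) :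
    Measure ((Fin 4 → ℝ) × (Fin k → ℕ)) :=
  (XLaw p lam0 lam1).bind fun x =>
    (Measure.pi fun i => poissonMeasure (T (idx i) * ∑ j ∈ sens (idx i), x j)).map
      (fun y => (x, y))

open scoped ENNReal

section Entropy

variable {ι α β : Type*} [Fintype ι]

/-- The summand of the conditional entropy of the index `x`, for an unnormalized weight `v`. -/
def surprisal (v : ι → ℝ) (x : ι) : ℝ :=
  v x * (log (∑ i, v i) - log (v x))

/-- Entropy of an unnormalized weight `v`, scaled by its total mass. -/
def massEntropy (v : ι → ℝ) : ℝ≥0∞ :=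
  ∑ x, ENNReal.ofReal (surprisal v x)

lemma surprisal_nonneg {v : ι → ℝ} (hv : ∀ x, 0 ≤ v x) (x : ι) : 0 ≤ surprisal v x := by
  rcases (hv x).eq_or_lt with h | h
  · simp [surprisal, ← h]
  · refine mul_nonneg h.le (sub_nonneg.2 (log_le_log h ?_))
    exact Finset.single_le_sum (fun i _ => hv i) (Finset.mem_univ x)

lemma sum_surprisal (v : ι → ℝ) :
    ∑ x, surprisal v x = (∑ x, negMulLog (v x)) - negMulLog (∑ x, v x) := by
  simp only [surprisal, negMulLog, mul_sub, Finset.sum_sub_distrib, ← Finset.sum_mul,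
    neg_mul, Finset.sum_neg_distrib]
  ring

lemma massEntropy_eq_ofReal {v : ι → ℝ} (hv : ∀ x, 0 ≤ v x) :
    massEntropy v = ENNReal.ofReal ((∑ x, negMulLog (v x)) - negMulLog (∑ x, v x)) := by
  rw [← sum_surprisal, ENNReal.ofReal_sum_of_nonneg fun x _ => surprisal_nonneg hv x, massEntropy]

lemma massEntropy_ne_top (v : ι → ℝ) : massEntropy v ≠ ∞ := by
  simp [massEntropy]

lemma surprisal_const_mul {c : ℝ} {v : ι → ℝ} (hv : ∀ x, 0 ≤ v x) (x : ι) :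
    surprisal (fun i => c * v i) x = c * surprisal v x := by
  rcases eq_or_ne c 0 with rfl | hc
  · simp [surprisal]
  rcases (hv x).eq_or_lt with hx | hx
  · simp [surprisal, ← hx]
  have hs : 0 < ∑ i, v i := Finset.sum_pos' (fun i _ => hv i) ⟨x, Finset.mem_univ x, hx⟩
  simp only [surprisal, ← Finset.mul_sum, log_mul hc hx.ne', log_mul hc hs.ne']
  ring

lemma massEntropy_const_mul {c : ℝ} (hc : 0 ≤ c) {v : ι → ℝ} (hv : ∀ x, 0 ≤ v x) :
    massEntropy (fun i => c * v i) = ENNReal.ofReal c * massEntropy v := by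
  simp only [massEntropy, surprisal_const_mul hv, ENNReal.ofReal_mul hc, Finset.mul_sum]

/-- Pointwise form of the submodularity of entropy for two observations that are conditionally
independent given the hidden index. -/
lemma sum_surprisal_mul_add_le {v a b : ι → ℝ} (hv : ∀ x, 0 ≤ v x) (ha : ∀ x, 0 ≤ a x)
    (hb : ∀ x, 0 ≤ b x) :
    (∑ x, b x * surprisal (fun i => v i * a i) x) + (∑ x, a x * surprisal (fun i => v i * b i) x)
        + ∑ x, v x * a x * b x ≤
      (∑ x, a x * b x * surprisal v x) + (∑ x, surprisal (fun i => v i * a i * b i) x)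
        + (∑ x, v x * a x) * (∑ x, v x * b x) / ∑ x, v x := by
  set S := ∑ x, v x with hS
  set A := ∑ x, v x * a x with hA
  set B := ∑ x, v x * b x with hB
  set V := ∑ x, v x * a x * b x with hV
  have hterm : ∀ x, b x * surprisal (fun i => v i * a i) x + a x * surprisal (fun i => v i * b i) x
      + v x * a x * b x * (log S + log V - log A - log B)
      = a x * b x * surprisal v x + surprisal (fun i => v i * a i * b i) x := by
    intro x
    simp only [surprisal, ← hS, ← hA, ← hB, ← hV]
    rcases eq_or_ne (v x) 0 with h1 | h1
    · simp [h1]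
    rcases eq_or_ne (a x) 0 with h2 | h2
    · simp [h2]
    rcases eq_or_ne (b x) 0 with h3 | h3
    · simp [h3]
    rw [log_mul (mul_ne_zero h1 h2) h3, log_mul h1 h2, log_mul h1 h3]
    ring
  have hsum := Finset.sum_congr (rfl : Finset.univ = Finset.univ) fun x _ => hterm x
  simp only [Finset.sum_add_distrib, ← Finset.sum_mul, ← hV] at hsum
  have hV0 : 0 ≤ V := Finset.sum_nonneg fun x _ => mul_nonneg (mul_nonneg (hv x) (ha x)) (hb x)
  suffices V ≤ V * (log S + log V - log A - log B) + A * B / S by linarith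
  have hS0 : 0 ≤ S := Finset.sum_nonneg fun x _ => hv x
  have hA0 : 0 ≤ A := Finset.sum_nonneg fun x _ => mul_nonneg (hv x) (ha x)
  have hB0 : 0 ≤ B := Finset.sum_nonneg fun x _ => mul_nonneg (hv x) (hb x)
  rcases hV0.eq_or_lt with h0 | hpos
  · rw [← h0]
    simp only [zero_mul, zero_add]
    positivity
  obtain ⟨x, -, hx⟩ : ∃ x ∈ Finset.univ, 0 < v x * a x * b x := by
    by_contra! h
    exact hpos.not_ge (Finset.sum_nonpos h)
  have hvx : 0 < v x := (hv x).lt_of_ne' fun h => by simp [h] at hx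
  have hax : 0 < a x := (ha x).lt_of_ne' fun h => by simp [h] at hx
  have hbx : 0 < b x := (hb x).lt_of_ne' fun h => by simp [h] at hx
  have hSp : 0 < S := Finset.sum_pos' (fun x _ => hv x) ⟨x, Finset.mem_univ x, hvx⟩
  have hAp : 0 < A := Finset.sum_pos' (fun x _ => mul_nonneg (hv x) (ha x))
    ⟨x, Finset.mem_univ x, mul_pos hvx hax⟩
  have hBp : 0 < B := Finset.sum_pos' (fun x _ => mul_nonneg (hv x) (hb x))
    ⟨x, Finset.mem_univ x, mul_pos hvx hbx⟩
  have hlog := log_le_sub_one_of_pos (show 0 < A * B / (S * V) by positivity)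
  rw [log_div (by positivity) (by positivity), log_mul hAp.ne' hBp.ne',
    log_mul hSp.ne' hpos.ne'] at hlog
  have hmul := mul_le_mul_of_nonneg_left hlog hpos.le
  have : V * (A * B / (S * V) - 1) = A * B / S - V := by field_simp
  linarith

lemma ENNReal.tsum_fintype_sum (f : ι → α → ℝ≥0∞) :
    ∑' a, ∑ x, f x a = ∑ x, ∑' a, f x a :=
  Summable.tsum_finsetSum fun _ _ => ENNReal.summable

/-- Submodularity of entropy: if two observations with laws `p x` and `q x` are conditionally
independent given the hidden index `x`, their mutual information is nonnegative. -/
lemma tsum_massEntropy_add_le {v : ι → ℝ} {p : ι → α → ℝ} {q : ι → β → ℝ}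
    (hv : ∀ x, 0 ≤ v x) (hp : ∀ x z, 0 ≤ p x z) (hq : ∀ x w, 0 ≤ q x w)
    (hp1 : ∀ x, ∑' z, ENNReal.ofReal (p x z) = 1) (hq1 : ∀ x, ∑' w, ENNReal.ofReal (q x w) = 1) :
    (∑' z, massEntropy fun x => v x * p x z) + (∑' w, massEntropy fun x => v x * q x w) ≤
      massEntropy v + ∑' z, ∑' w, massEntropy fun x => v x * p x z * q x w := by
  have hpair : ∀ z w,
      (∑ x, ENNReal.ofReal (q x w) * ENNReal.ofReal (surprisal (fun i => v i * p i z) x))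
        + (∑ x, ENNReal.ofReal (p x z) * ENNReal.ofReal (surprisal (fun i => v i * q i w) x))
        + ∑ x, ENNReal.ofReal (v x) * (ENNReal.ofReal (p x z) * ENNReal.ofReal (q x w)) ≤
      (∑ x, ENNReal.ofReal (surprisal v x) * (ENNReal.ofReal (p x z) * ENNReal.ofReal (q x w)))
        + (massEntropy fun x => v x * p x z * q x w)
        + ∑ x, ∑ y, ENNReal.ofReal (v x * v y / ∑ i, v i) *
          (ENNReal.ofReal (p x z) * ENNReal.ofReal (q y w)) := by
    intro z w
    have h := sum_surprisal_mul_add_le hv (fun x => hp x z) (fun x => hq x w)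
    have n1 := fun x => surprisal_nonneg hv x
    have n2 := fun x => surprisal_nonneg (fun i => mul_nonneg (hv i) (hp i z)) x
    have n3 := fun x => surprisal_nonneg (fun i => mul_nonneg (hv i) (hq i w)) x
    have n4 := fun x => surprisal_nonneg
      (fun i => mul_nonneg (mul_nonneg (hv i) (hp i z)) (hq i w)) x
    have hS : 0 ≤ ∑ i, v i := Finset.sum_nonneg fun i _ => hv i
    have hAB : (∑ x, v x * p x z) * (∑ x, v x * q x w) / ∑ x, v x =
        ∑ x, ∑ y, (v x * v y / ∑ i, v i) * (p x z * q y w) := by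
      rw [Finset.sum_mul_sum, Finset.sum_div]
      refine Finset.sum_congr rfl fun x _ => ?_
      rw [Finset.sum_div]
      exact Finset.sum_congr rfl fun y _ => by ring
    rw [hAB] at h
    have e1 : ENNReal.ofReal (∑ x, q x w * surprisal (fun i => v i * p i z) x) =
        ∑ x, ENNReal.ofReal (q x w) * ENNReal.ofReal (surprisal (fun i => v i * p i z) x) := by
      rw [ENNReal.ofReal_sum_of_nonneg fun x _ => mul_nonneg (hq x w) (n2 x)]
      simp only [ENNReal.ofReal_mul (hq _ _)]
    have e2 : ENNReal.ofReal (∑ x, p x z * surprisal (fun i => v i * q i w) x) =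
        ∑ x, ENNReal.ofReal (p x z) * ENNReal.ofReal (surprisal (fun i => v i * q i w) x) := by
      rw [ENNReal.ofReal_sum_of_nonneg fun x _ => mul_nonneg (hp x z) (n3 x)]
      simp only [ENNReal.ofReal_mul (hp _ _)]
    have e3 : ENNReal.ofReal (∑ x, v x * p x z * q x w) =
        ∑ x, ENNReal.ofReal (v x) * (ENNReal.ofReal (p x z) * ENNReal.ofReal (q x w)) := by
      rw [ENNReal.ofReal_sum_of_nonneg fun x _ => mul_nonneg (mul_nonneg (hv x) (hp x z)) (hq x w)]
      simp only [mul_assoc, ENNReal.ofReal_mul (hv _), ENNReal.ofReal_mul (hp _ _)]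
    have e4 : ENNReal.ofReal (∑ x, p x z * q x w * surprisal v x) =
        ∑ x, ENNReal.ofReal (surprisal v x) *
          (ENNReal.ofReal (p x z) * ENNReal.ofReal (q x w)) := by
      rw [ENNReal.ofReal_sum_of_nonneg fun x _ => mul_nonneg (mul_nonneg (hp x z) (hq x w)) (n1 x)]
      simp only [mul_comm _ (surprisal v _), ENNReal.ofReal_mul (n1 _), ENNReal.ofReal_mul (hp _ _)]
    have e5 : ENNReal.ofReal (∑ x, surprisal (fun i => v i * p i z * q i w) x) =
        massEntropy fun x => v x * p x z * q x w := by
      rw [ENNReal.ofReal_sum_of_nonneg fun x _ => n4 x, massEntropy]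
    have hvS : ∀ x y, 0 ≤ v x * v y / ∑ i, v i := fun x y =>
      div_nonneg (mul_nonneg (hv x) (hv y)) hS
    have hpq : ∀ x y, 0 ≤ p x z * q y w := fun x y => mul_nonneg (hp x z) (hq y w)
    have e6 : ENNReal.ofReal (∑ x, ∑ y, (v x * v y / ∑ i, v i) * (p x z * q y w)) =
        ∑ x, ∑ y, ENNReal.ofReal (v x * v y / ∑ i, v i) *
          (ENNReal.ofReal (p x z) * ENNReal.ofReal (q y w)) := by
      rw [ENNReal.ofReal_sum_of_nonneg fun x _ => Finset.sum_nonneg fun y _ =>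
        mul_nonneg (hvS x y) (hpq x y)]
      refine Finset.sum_congr rfl fun x _ => ?_
      rw [ENNReal.ofReal_sum_of_nonneg fun y _ => mul_nonneg (hvS x y) (hpq x y)]
      simp only [ENNReal.ofReal_mul (hvS _ _), ENNReal.ofReal_mul (hp _ _)]
    rw [← e1, ← e2, ← e3, ← e4, ← e5, ← e6]
    have m1 := Finset.sum_nonneg fun x (_ : x ∈ Finset.univ) => mul_nonneg (hq x w) (n2 x)
    have m2 := Finset.sum_nonneg fun x (_ : x ∈ Finset.univ) => mul_nonneg (hp x z) (n3 x)
    have m3 := Finset.sum_nonneg fun x (_ : x ∈ Finset.univ) =>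
      mul_nonneg (mul_nonneg (hv x) (hp x z)) (hq x w)
    rw [← ENNReal.ofReal_add m1 m2, ← ENNReal.ofReal_add (add_nonneg m1 m2) m3]
    exact (ENNReal.ofReal_le_ofReal h).trans
      (ENNReal.ofReal_add_le.trans (add_le_add_left ENNReal.ofReal_add_le _))
  have hsum := ENNReal.tsum_le_tsum fun z => ENNReal.tsum_le_tsum fun w => hpair z w
  simp only [massEntropy, ENNReal.tsum_add, ENNReal.tsum_fintype_sum, ENNReal.tsum_mul_left,
    ENNReal.tsum_mul_right, hq1, hp1, mul_one, one_mul] at hsum ⊢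
  have hmass : ∑ x, ∑ y, ENNReal.ofReal (v x * v y / ∑ i, v i) ≤ ∑ x, ENNReal.ofReal (v x) := by
    refine Finset.sum_le_sum fun x _ => ?_
    rw [← ENNReal.ofReal_sum_of_nonneg fun y _ => div_nonneg (mul_nonneg (hv x) (hv y))
      (Finset.sum_nonneg fun i _ => hv i), ← Finset.sum_div, ← Finset.mul_sum]
    exact ENNReal.ofReal_le_ofReal (div_le_of_le_mul₀ (Finset.sum_nonneg fun i _ => hv i) (hv x) le_rfl)
  exact (ENNReal.add_le_add_iff_right (by simp)).1 (hsum.trans (add_le_add_right hmass _))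

/-- Conditioning on an observation does not increase entropy. -/
lemma tsum_massEntropy_le {v : ι → ℝ} {p : ι → α → ℝ} (hv : ∀ x, 0 ≤ v x)
    (hp : ∀ x z, 0 ≤ p x z) (hp1 : ∀ x, ∑' z, ENNReal.ofReal (p x z) = 1) :
    (∑' z, massEntropy fun x => v x * p x z) ≤ massEntropy v := by
  classical
  let q : ι → ι → ℝ := fun x w => if w = x then 1 else 0
  have hq : ∀ x w, 0 ≤ q x w := fun x w => by simp only [q]; split_ifs <;> norm_num
  have hq1 : ∀ x, ∑' w, ENNReal.ofReal (q x w) = 1 := fun x => by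
    simp [q, apply_ite ENNReal.ofReal]
  have hdet : ∀ (u : ι → ℝ) (w : ι), massEntropy (fun x => u x * q x w) = 0 := fun u w => by
    refine Finset.sum_eq_zero fun x _ => ?_
    rcases eq_or_ne w x with rfl | hx
    · simp [surprisal, q]
    · simp [surprisal, q, hx]
  have h := tsum_massEntropy_add_le hv hp hq hp1 hq1
  simpa only [hdet, tsum_zero, add_zero] using h

end Entropy

section Poisson

variable {ι κ : Type*} [Fintype ι] [Fintype κ]

open scoped Nat

/-- Mass function of a vector of independent Poisson variables with rates `t * r i`. -/
def poissonWeight (t : ℝ) (r : κ → ℝ) (y : κ → ℕ) : ℝ :=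
  ∏ i, (exp (-(t * r i)) * (t * r i) ^ y i / (y i)!)

/-- Conditional law of the first of two independent Poisson vectors, observed for times `t` and
`s`, given that their sum is `n`. -/
def binomialWeight (t s : ℝ) (n y : κ → ℕ) : ℝ :=
  ∏ i, (t ^ y i * s ^ (n i - y i) * (n i).choose (y i) / (t + s) ^ n i)

lemma poissonWeight_nonneg {t : ℝ} (ht : 0 ≤ t) {r : κ → ℝ} (hr : ∀ i, 0 ≤ r i) (y : κ → ℕ) :
    0 ≤ poissonWeight t r y :=
  Finset.prod_nonneg fun i _ => by have := mul_nonneg ht (hr i); positivity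

set_option linter.deprecated false in
lemma poissonMeasure_singleton_of_nonneg {r : ℝ} (hr : 0 ≤ r) (n : ℕ) :
    _root_.poissonMeasure r {n} = ENNReal.ofReal (exp (-r) * r ^ n / n !) := by
  rw [_root_.poissonMeasure, PMF.toMeasure_apply_singleton _ _ (measurableSet_singleton n),
    ← poissonPMFReal_ofReal_eq_poissonPMF, poissonPMFReal, Real.coe_toNNReal _ hr]

instance (r : ℝ) : IsProbabilityMeasure (_root_.poissonMeasure r) := by
  unfold _root_.poissonMeasure; infer_instance

lemma pi_poissonMeasure_singleton {t : ℝ} (ht : 0 ≤ t) {r : κ → ℝ} (hr : ∀ i, 0 ≤ r i)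
    (y : κ → ℕ) :
    (Measure.pi fun i => _root_.poissonMeasure (t * r i)) {y} =
      ENNReal.ofReal (poissonWeight t r y) := by
  have h := fun i => mul_nonneg ht (hr i)
  rw [Measure.pi_singleton, poissonWeight, ENNReal.ofReal_prod_of_nonneg fun i _ => by
    have := h i; positivity]
  exact Finset.prod_congr rfl fun i _ => poissonMeasure_singleton_of_nonneg (h i) _

lemma tsum_poissonWeight {t : ℝ} (ht : 0 ≤ t) {r : κ → ℝ} (hr : ∀ i, 0 ≤ r i) :
    ∑' y, ENNReal.ofReal (poissonWeight t r y) = 1 := by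
  simp only [← pi_poissonMeasure_singleton ht hr]
  have := Measure.tsum_indicator_apply_singleton
    (Measure.pi fun i => _root_.poissonMeasure (t * r i)) Set.univ MeasurableSet.univ
  simpa using this

lemma binomialWeight_nonneg {t s : ℝ} (ht : 0 ≤ t) (hs : 0 ≤ s) (n y : κ → ℕ) :
    0 ≤ binomialWeight t s n y :=
  Finset.prod_nonneg fun i _ => by positivity

lemma binomialWeight_eq_zero {t s : ℝ} {n y : κ → ℕ} (h : ¬ y ≤ n) :
    binomialWeight t s n y = 0 := by
  obtain ⟨i, hi⟩ := not_forall.1 h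
  exact Finset.prod_eq_zero (Finset.mem_univ i) (by simp [Nat.choose_eq_zero_of_lt (not_le.1 hi)])

lemma tsum_binomialWeight {t s : ℝ} (ht : 0 ≤ t) (hs : 0 ≤ s) (hts : 0 < t + s) (n : κ → ℕ) :
    ∑' y, ENNReal.ofReal (binomialWeight t s n y) = 1 := by
  classical
  rw [tsum_eq_sum (s := Fintype.piFinset fun i => Finset.range (n i + 1)),
    ← ENNReal.ofReal_sum_of_nonneg fun y _ => binomialWeight_nonneg ht hs n y]
  · simp only [binomialWeight]
    rw [← Finset.prod_univ_sum (fun i => Finset.range (n i + 1))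
      fun i m => t ^ m * s ^ (n i - m) * (n i).choose m / (t + s) ^ n i]
    simp only [← Finset.sum_div, ← add_pow]
    simp [hts.ne']
  · intro y hy
    rw [binomialWeight_eq_zero, ENNReal.ofReal_zero]
    simpa [Pi.le_def, Nat.lt_succ_iff] using hy

lemma poissonWeight_mul_poissonWeight {t s : ℝ} (hts : 0 < t + s) (r : κ → ℝ) (y z : κ → ℕ) :
    poissonWeight t r y * poissonWeight s r z =
      binomialWeight t s (y + z) y * poissonWeight (t + s) r (y + z) := by
  simp only [poissonWeight, binomialWeight, ← Finset.prod_mul_distrib]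
  refine Finset.prod_congr rfl fun i _ => ?_
  have hc : (((y i + z i).choose (y i) : ℕ) : ℝ) = (y i + z i)! / ((y i)! * (z i)!) := by
    rw [Nat.cast_add_choose]
  have hexp : exp (-((t + s) * r i)) = exp (-(t * r i)) * exp (-(s * r i)) := by
    rw [← exp_add]; ring_nf
  rw [Pi.add_apply, Nat.add_sub_cancel_left, hc, hexp, mul_pow, mul_pow, mul_pow, pow_add (r i)]
  have : (t + s) ^ (y i + z i) ≠ 0 := (pow_pos hts _).ne'
  field_simp

/-- Entropy of the index with weights `v`, given the Poisson vector observed for time `t`. -/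
def condEntropy (v : ι → ℝ) (r : ι → κ → ℝ) (t : ℝ) : ℝ≥0∞ :=
  ∑' y, massEntropy fun x => v x * poissonWeight t (r x) y

variable {v : ι → ℝ} {r : ι → κ → ℝ} {t s : ℝ}

lemma condEntropy_add (hv : ∀ x, 0 ≤ v x) (hr : ∀ x i, 0 ≤ r x i) (ht : 0 ≤ t) (hs : 0 ≤ s)
    (hts : 0 < t + s) :
    condEntropy v r (t + s) =
      ∑' y, condEntropy (fun x => v x * poissonWeight t (r x) y) r s := by
  set F : (κ → ℕ) → ℝ≥0∞ := fun n => massEntropy fun x => v x * poissonWeight (t + s) (r x) n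
    with hF
  have hsplit : ∀ y z : κ → ℕ,
      (massEntropy fun x => v x * poissonWeight t (r x) y * poissonWeight s (r x) z) =
        ENNReal.ofReal (binomialWeight t s (y + z) y) * F (y + z) := by
    intro y z
    rw [hF, ← massEntropy_const_mul (binomialWeight_nonneg ht hs _ _) fun x =>
      mul_nonneg (hv x) (poissonWeight_nonneg hts.le (hr x) _)]
    congr 1
    ext x
    rw [mul_assoc, poissonWeight_mul_poissonWeight hts]
    ring
  have hshift : ∀ y : κ → ℕ,
      ∑' z, ENNReal.ofReal (binomialWeight t s (y + z) y) * F (y + z) =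
        ∑' n, ENNReal.ofReal (binomialWeight t s n y) * F n := by
    intro y
    refine (add_right_injective y).tsum_eq
      (f := fun n => ENNReal.ofReal (binomialWeight t s n y) * F n) fun n hn => ?_
    have hyn : y ≤ n := by
      by_contra h
      simp [binomialWeight_eq_zero h] at hn
    exact ⟨n - y, add_tsub_cancel_of_le hyn⟩
  simp only [condEntropy, hsplit, hshift]
  rw [ENNReal.tsum_comm]
  simp only [ENNReal.tsum_mul_right, tsum_binomialWeight ht hs hts, one_mul, hF]

lemma condEntropy_le (hv : ∀ x, 0 ≤ v x) (hr : ∀ x i, 0 ≤ r x i) (ht : 0 ≤ t) :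
    condEntropy v r t ≤ massEntropy v :=
  tsum_massEntropy_le hv (fun x => poissonWeight_nonneg ht (hr x))
    fun x => tsum_poissonWeight ht (hr x)

lemma condEntropy_ne_top (hv : ∀ x, 0 ≤ v x) (hr : ∀ x i, 0 ≤ r x i) (ht : 0 ≤ t) :
    condEntropy v r t ≠ ∞ :=
  ne_top_of_le_ne_top (massEntropy_ne_top v) (condEntropy_le hv hr ht)

lemma condEntropy_midpoint (hv : ∀ x, 0 ≤ v x) (hr : ∀ x i, 0 ≤ r x i) (ht : 0 ≤ t) (hs : 0 < s) :
    condEntropy v r (t + s) + condEntropy v r (t + s) ≤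
      condEntropy v r t + condEntropy v r (t + (s + s)) := by
  rw [condEntropy_add hv hr ht hs.le (by positivity),
    condEntropy_add hv hr ht (add_pos hs hs).le (by positivity), condEntropy, ← ENNReal.tsum_add,
    ← ENNReal.tsum_add]
  refine ENNReal.tsum_le_tsum fun y => ?_
  have hvy : ∀ x, 0 ≤ v x * poissonWeight t (r x) y := fun x =>
    mul_nonneg (hv x) (poissonWeight_nonneg ht (hr x) y)
  have hp : ∀ x z, 0 ≤ poissonWeight s (r x) z := fun x => poissonWeight_nonneg hs.le (hr x)
  have hp1 := fun x => tsum_poissonWeight hs.le (hr x)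
  rw [condEntropy_add hvy hr hs.le hs.le (by positivity)]
  exact tsum_massEntropy_add_le hvy hp hp hp1 hp1

/-- A midpoint convex function that is bounded on an interval is convex there. -/
lemma convexOn_Ici_of_midpoint {f : ℝ → ℝ} {m M a : ℝ} (hm : ∀ t, a ≤ t → m ≤ f t)
    (hM : ∀ t, a ≤ t → f t ≤ M)
    (hf : ∀ t, a ≤ t → ∀ s, 0 < s → f (t + s) + f (t + s) ≤ f t + f (t + (s + s))) :
    ConvexOn ℝ (Set.Ici a) f := by
  refine ⟨convex_Ici a, fun x hx y hy p q hp hq hpq => ?_⟩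
  obtain rfl : p = 1 - q := by linarith
  have hq1 : q ≤ 1 := by linarith
  have hmem : ∀ c, 0 ≤ c → c ≤ 1 → a ≤ x + c * (y - x) := fun c h0 h1 => by
    have := Set.mem_Ici.1 hx
    have := Set.mem_Ici.1 hy
    nlinarith
  have hmid : ∀ u w, a ≤ u → a ≤ w → f ((u + w) / 2) ≤ (f u + f w) / 2 := by
    intro u w hu hw
    rcases lt_trichotomy u w with h | rfl | h
    · have := hf u hu ((w - u) / 2) (by linarith)
      rw [show u + (w - u) / 2 = (u + w) / 2 by ring,
        show u + ((w - u) / 2 + (w - u) / 2) = w by ring] at this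
      linarith
    · simp
    · have := hf w hw ((u - w) / 2) (by linarith)
      rw [show w + (u - w) / 2 = (u + w) / 2 by ring,
        show w + ((u - w) / 2 + (u - w) / 2) = u by ring] at this
      linarith
  set h : ℝ → ℝ := fun c => f (x + c * (y - x)) - ((1 - c) * f x + c * f y) with hh
  have h0 : h 0 = 0 := by simp [hh]
  have h1 : h 1 = 0 := by simp [hh]
  have hhmid : ∀ c d, 0 ≤ c → c ≤ 1 → 0 ≤ d → d ≤ 1 → h ((c + d) / 2) ≤ (h c + h d) / 2 := by
    intro c d hc0 hc1 hd0 hd1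
    have := hmid _ _ (hmem c hc0 hc1) (hmem d hd0 hd1)
    rw [show (x + c * (y - x) + (x + d * (y - x))) / 2 = x + (c + d) / 2 * (y - x) by ring] at this
    simp only [hh]
    linarith
  have hbound : ∀ n : ℕ, ∀ c, 0 ≤ c → c ≤ 1 → h c ≤ (M - m) / 2 ^ n := by
    intro n
    induction n with
    | zero =>
      intro c hc0 hc1
      have := hM _ (hmem c hc0 hc1)
      have := hm x hx
      have := hm y hy
      simp only [hh, pow_zero, div_one]
      nlinarith
    | succ n ih =>
      intro c hc0 hc1
      rw [pow_succ, ← div_div]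
      rcases le_total c (1 / 2) with hc | hc
      · have := hhmid 0 (2 * c) le_rfl zero_le_one (by linarith) (by linarith)
        rw [show (0 + 2 * c) / 2 = c by ring, h0] at this
        linarith [ih (2 * c) (by linarith) (by linarith)]
      · have := hhmid (2 * c - 1) 1 (by linarith) (by linarith) zero_le_one le_rfl
        rw [show (2 * c - 1 + 1) / 2 = c by ring, h1] at this
        linarith [ih (2 * c - 1) (by linarith) (by linarith)]
  have hlim : Tendsto (fun n : ℕ => (M - m) / 2 ^ n) atTop (nhds 0) :=
    tendsto_const_nhds.div_atTop (tendsto_pow_atTop_atTop_of_one_lt one_lt_two)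
  have hq0 : h q ≤ 0 := ge_of_tendsto' hlim fun n => hbound n q hq hq1
  simp only [hh] at hq0
  simp only [smul_eq_mul]
  rw [show (1 - q) * x + q * y = x + q * (y - x) by ring]
  linarith

lemma convexOn_condEntropy (hv : ∀ x, 0 ≤ v x) (hr : ∀ x i, 0 ≤ r x i) :
    ConvexOn ℝ (Set.Ici 0) fun t => (condEntropy v r t).toReal := by
  refine convexOn_Ici_of_midpoint (m := 0) (M := (massEntropy v).toReal)
    (fun t _ => ENNReal.toReal_nonneg)
    (fun t ht => ENNReal.toReal_mono (massEntropy_ne_top v) (condEntropy_le hv hr ht))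
    fun t ht s hs => ?_
  have hfin : ∀ u, 0 ≤ u → condEntropy v r u ≠ ∞ := fun u hu => condEntropy_ne_top hv hr hu
  have h1 := hfin (t + s) (by positivity)
  have h2 := hfin (t + (s + s)) (by positivity)
  rw [← ENNReal.toReal_add h1 h1, ← ENNReal.toReal_add (hfin t ht) h2]
  exact ENNReal.toReal_mono (ENNReal.add_ne_top.2 ⟨hfin t ht, h2⟩)
    (condEntropy_midpoint hv hr ht hs)

end Poisson

section Mixture

variable {ι S U : Type*} [Fintype ι] [MeasurableSpace S] [MeasurableSpace U]

lemma measureEntropy_eq_tsum_real (μ : Measure S) [IsProbabilityMeasure μ] :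
    measureEntropy μ = ∑' s, negMulLog (μ.real {s}) := by
  simp [measureEntropy, measureReal_def]

lemma massEntropy_toReal {v : ι → ℝ} (hv : ∀ x, 0 ≤ v x) :
    (massEntropy v).toReal = (∑ x, negMulLog (v x)) - negMulLog (∑ x, v x) := by
  rw [massEntropy_eq_ofReal hv, ENNReal.toReal_ofReal]
  rw [← sum_surprisal]
  exact Finset.sum_nonneg fun x _ => surprisal_nonneg hv x

/-- Law of a pair `(φ b, Y)`, where `b` has weights `w` and `Y` has law `ν b` given `b`. -/
def mixtureLaw (w : ι → ℝ) (φ : ι → S) (ν : ι → Measure U) : Measure (S × U) :=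
  ∑ b, ENNReal.ofReal (w b) • (ν b).map (Prod.mk (φ b))

variable {w : ι → ℝ} {φ : ι → S} {ν : ι → Measure U}

lemma isProbabilityMeasure_sum_ofReal_smul {Ω : Type*} [MeasurableSpace Ω] (hw : ∀ b, 0 ≤ w b)
    (hw1 : ∑ b, w b = 1) (ρ : ι → Measure Ω) [∀ b, IsProbabilityMeasure (ρ b)] :
    IsProbabilityMeasure (∑ b, ENNReal.ofReal (w b) • ρ b) := by
  constructor
  simp [← ENNReal.ofReal_sum_of_nonneg fun b _ => hw b, hw1]

lemma sum_ofReal_smul_real_apply {Ω : Type*} [MeasurableSpace Ω] (hw : ∀ b, 0 ≤ w b)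
    (ρ : ι → Measure Ω) [∀ b, IsProbabilityMeasure (ρ b)] (s : Set Ω) :
    (∑ b, ENNReal.ofReal (w b) • ρ b).real s = ∑ b, w b * (ρ b).real s := by
  simp only [measureReal_def, Measure.coe_finsetSum, Finset.sum_apply, Measure.smul_apply,
    smul_eq_mul]
  rw [ENNReal.toReal_sum fun b _ => ENNReal.mul_ne_top ENNReal.ofReal_ne_top (measure_ne_top _ _)]
  simp [ENNReal.toReal_ofReal (hw _)]

lemma mixtureLaw_map_fst [∀ b, IsProbabilityMeasure (ν b)] :
    (mixtureLaw w φ ν).map Prod.fst = ∑ b, ENNReal.ofReal (w b) • Measure.dirac (φ b) := by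
  rw [mixtureLaw, Measure.map_finset_sum measurable_fst.aemeasurable]
  refine Finset.sum_congr rfl fun b _ => ?_
  rw [Measure.map_smul, Measure.map_map measurable_fst measurable_prodMk_left]
  congr 1
  exact (Measure.map_const (ν b) (φ b)).trans (by simp)

lemma mixtureLaw_map_snd :
    (mixtureLaw w φ ν).map Prod.snd = ∑ b, ENNReal.ofReal (w b) • ν b := by
  rw [mixtureLaw, Measure.map_finset_sum measurable_snd.aemeasurable]
  refine Finset.sum_congr rfl fun b _ => ?_
  rw [Measure.map_smul, Measure.map_map measurable_snd measurable_prodMk_left]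
  congr 1
  exact Measure.map_id

lemma summable_negMulLog_mul {α : Type*} {p : α → ℝ} (c : ℝ) (hp : Summable p)
    (hp' : Summable fun y => negMulLog (p y)) : Summable fun y => negMulLog (c * p y) := by
  simp only [negMulLog_mul]
  exact (hp.mul_right _).add (hp'.mul_left c)

lemma summable_measureReal_singleton [Countable U] [MeasurableSingletonClass U] (ρ : Measure U)
    [IsProbabilityMeasure ρ] : Summable fun y => ρ.real {y} := by
  refine ENNReal.summable_toReal ?_
  have := Measure.tsum_indicator_apply_singleton ρ Set.univ MeasurableSet.univ
  simp only [Set.indicator_univ] at this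
  simp [this]

lemma measureMutualInfo_mixtureLaw [MeasurableSingletonClass S] [Countable U]
    [MeasurableSingletonClass U] (hw : ∀ b, 0 ≤ w b) (hw1 : ∑ b, w b = 1)
    (hφ : Function.Injective φ) [∀ b, IsProbabilityMeasure (ν b)]
    (hν : ∀ b, Summable fun y => negMulLog ((ν b).real {y})) :
    measureMutualInfo (mixtureLaw w φ ν) =
      (massEntropy w).toReal - (∑' y, massEntropy fun b => w b * (ν b).real {y}).toReal := by
  classical
  have hmap : ∀ b, IsProbabilityMeasure ((ν b).map (Prod.mk (φ b))) := fun b =>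
    Measure.isProbabilityMeasure_map measurable_prodMk_left.aemeasurable
  have hjoint : IsProbabilityMeasure (mixtureLaw w φ ν) := isProbabilityMeasure_sum_ofReal_smul hw hw1 _
  have hfst := isProbabilityMeasure_sum_ofReal_smul hw hw1 fun b => Measure.dirac (φ b)
  have hsnd := isProbabilityMeasure_sum_ofReal_smul hw hw1 ν
  have hX : measureEntropy ((mixtureLaw w φ ν).map Prod.fst) = ∑ b, negMulLog (w b) := by
    rw [mixtureLaw_map_fst, measureEntropy_eq_tsum_real]
    simp only [sum_ofReal_smul_real_apply hw]
    have hdirac : ∀ c, ∑ b, w b * (Measure.dirac (φ b)).real {φ c} = w c := fun c => by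
      rw [Finset.sum_eq_single c]
      · simp [measureReal_def]
      · intro b _ hb
        simp [measureReal_def, hφ.ne hb]
      · simp
    rw [← hφ.tsum_eq, tsum_fintype]
    · exact Finset.sum_congr rfl fun c _ => by rw [hdirac]
    · intro x hx
      by_contra h
      refine hx ?_
      have : ∀ b, φ b ≠ x := fun b hb => h ⟨b, hb⟩
      simp [measureReal_def, this]
  have hY : measureEntropy ((mixtureLaw w φ ν).map Prod.snd) =
      ∑' y, negMulLog (∑ b, w b * (ν b).real {y}) := by
    rw [mixtureLaw_map_snd, measureEntropy_eq_tsum_real]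
    simp only [sum_ofReal_smul_real_apply hw]
  have hsummable : ∀ b, Summable fun y => negMulLog (w b * (ν b).real {y}) := fun b =>
    summable_negMulLog_mul _ (summable_measureReal_singleton (ν b)) (hν b)
  have hpre : ∀ b x y, ((ν b).map (Prod.mk (φ b))).real {(x, y)} =
      if φ b = x then (ν b).real {y} else 0 := by
    intro b x y
    rw [measureReal_def, Measure.map_apply measurable_prodMk_left (measurableSet_singleton _)]
    split_ifs with h
    · rw [measureReal_def]
      congr 2
      ext z
      simp [h]
    · have : Prod.mk (φ b) ⁻¹' {(x, y)} = (∅ : Set U) := by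
        ext z
        simp [h]
      simp [this]
  have hXY : measureEntropy (mixtureLaw w φ ν) =
      ∑' y, ∑ b, negMulLog (w b * (ν b).real {y}) := by
    rw [measureEntropy_eq_tsum_real]
    simp only [mixtureLaw, sum_ofReal_smul_real_apply hw]
    have hinj : Function.Injective fun a : ι × U => (φ a.1, a.2) := fun a b h => by
      simp only [Prod.mk.injEq] at h
      exact Prod.ext (hφ h.1) h.2
    rw [← hinj.tsum_eq]
    · simp only [hpre, hφ.eq_iff, mul_ite, mul_zero, Finset.sum_ite_eq', Finset.mem_univ, if_true]
      have hprod : Summable fun a : ι × U => negMulLog (w a.1 * (ν a.1).real {a.2}) :=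
        Summable.of_norm <| (summable_prod_of_nonneg fun _ => norm_nonneg _).2
          ⟨fun b => (hsummable b).norm, Summable.of_finite⟩
      rw [Summable.tsum_finsetSum fun b _ => hsummable b, hprod.tsum_prod' hsummable, tsum_fintype]
    · rintro ⟨x, y⟩ hx
      by_contra h
      refine hx ?_
      have : ∀ b, φ b ≠ x := fun b hb => h ⟨(b, y), by simp [hb]⟩
      simp [hpre, this]
  have hwν : ∀ y b, 0 ≤ w b * (ν b).real {y} := fun y b => mul_nonneg (hw b) measureReal_nonneg
  have hle1 : ∀ y, ∑ b, w b * (ν b).real {y} ≤ 1 := fun y => hw1 ▸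
    Finset.sum_le_sum fun b _ => mul_le_of_le_one_right (hw b) measureReal_le_one
  have hsum := summable_sum fun b (_ : b ∈ Finset.univ) => hsummable b
  have hYsum : Summable fun y => negMulLog (∑ b, w b * (ν b).real {y}) := by
    refine hsum.of_nonneg_of_le
      (fun y => negMulLog_nonneg (Finset.sum_nonneg fun b _ => hwν y b) (hle1 y)) fun y => ?_
    have := massEntropy_toReal (hwν y)
    linarith [ENNReal.toReal_nonneg (a := massEntropy fun b => w b * (ν b).real {y})]
  rw [measureMutualInfo, hX, hY, hXY, ENNReal.tsum_toReal_eq fun y => massEntropy_ne_top _,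
    massEntropy_toReal hw, hw1, negMulLog_one]
  simp only [massEntropy_toReal (hwν _)]
  rw [hsum.tsum_sub hYsum]
  ring

end Mixture

section Summability

open scoped Nat

lemma negMulLog_le_add_exp {p : ℝ} (hp : 0 ≤ p) (a : ℝ) : negMulLog p ≤ a * p + exp (-a) := by
  rcases hp.eq_or_lt with rfl | hp
  · simp [exp_nonneg]
  have h := log_le_sub_one_of_pos (div_pos (exp_pos (-a)) hp)
  rw [log_div (exp_ne_zero _) hp.ne', log_exp] at h
  have hmul := mul_le_mul_of_nonneg_left h hp.le
  have : p * (exp (-a) / p - 1) = exp (-a) - p := by field_simp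
  rw [negMulLog]
  linarith

lemma summable_poisson (c : ℝ) : Summable fun n : ℕ => exp (-c) * c ^ n / n ! := by
  simpa only [mul_div_assoc] using (Real.summable_pow_div_factorial c).mul_left (exp (-c))

lemma poisson_le_one {c : ℝ} (hc : 0 ≤ c) (n : ℕ) : exp (-c) * c ^ n / n ! ≤ 1 := by
  rw [mul_div_assoc, exp_neg, inv_mul_le_one₀ (exp_pos c)]
  exact Real.pow_div_factorial_le_exp c hc n

lemma summable_negMulLog_poisson {c : ℝ} (hc : 0 ≤ c) :
    Summable fun n : ℕ => negMulLog (exp (-c) * c ^ n / n !) := by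
  have h0 : ∀ n : ℕ, 0 ≤ exp (-c) * c ^ n / n ! := fun n => by positivity
  have hmean : Summable fun n : ℕ => (n : ℝ) * (exp (-c) * c ^ n / n !) := by
    rw [← summable_nat_add_iff 1]
    refine ((summable_poisson c).mul_left c).congr fun n => ?_
    rw [Nat.factorial_succ]
    push_cast
    field_simp
    ring
  have hexp : Summable fun n : ℕ => exp (-(n : ℝ)) := Real.summable_exp_neg_nat
  exact (hmean.add hexp).of_nonneg_of_le (fun n => negMulLog_nonneg (h0 n) (poisson_le_one hc n))
    fun n => negMulLog_le_add_exp (h0 n) n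

lemma summable_prod_and_negMulLog_prod {k : ℕ} (p : Fin k → ℕ → ℝ) (hp : ∀ i, Summable (p i))
    (hp' : ∀ i, Summable fun n => negMulLog (p i n)) :
    Summable (fun y : Fin k → ℕ => ∏ i, p i (y i)) ∧
      Summable fun y : Fin k → ℕ => negMulLog (∏ i, p i (y i)) := by
  induction k with
  | zero => exact ⟨Summable.of_finite, Summable.of_finite⟩
  | succ k ih =>
    obtain ⟨h1, h2⟩ := ih (fun i => p i.succ) (fun i => hp _) fun i => hp' _
    constructor
    · rw [← (Fin.consEquiv fun _ => ℕ).summable_iff]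
      refine (summable_mul_of_summable_norm (hp 0).norm h1.norm).congr fun a => ?_
      simp [Fin.consEquiv, Fin.prod_univ_succ]
    · rw [← (Fin.consEquiv fun _ => ℕ).summable_iff]
      refine ((summable_mul_of_summable_norm (hp' 0).norm h1.norm).add
        (summable_mul_of_summable_norm (hp 0).norm h2.norm)).congr fun a => ?_
      simp [Fin.consEquiv, Fin.prod_univ_succ, negMulLog_mul]
      ring

end Summability

section JointLaw

variable {p lam0 lam1 : ℝ}

/-- Probability of the input vector coded by `b`. -/
def inputWeight (p : ℝ) (b : Fin 4 → Bool) : ℝ :=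
  ∏ j, if b j then p else 1 - p

/-- Input vector coded by `b`. -/
def inputVector (lam0 lam1 : ℝ) (b : Fin 4 → Bool) : Fin 4 → ℝ :=
  fun j => if b j then lam1 else lam0

lemma inputWeight_nonneg (hp0 : 0 < p) (hp1 : p < 1) (b : Fin 4 → Bool) : 0 ≤ inputWeight p b :=
  Finset.prod_nonneg fun j _ => by split_ifs <;> linarith

lemma sum_inputWeight : ∑ b, inputWeight p b = 1 := by
  have := Finset.prod_univ_sum (fun _ : Fin 4 => (Finset.univ : Finset Bool))
    fun _ c => if c then p else 1 - p
  rw [Fintype.piFinset_univ] at this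
  simpa only [inputWeight, Fintype.univ_bool, Finset.mem_singleton, Bool.true_eq_false,
    not_false_eq_true, Finset.sum_insert, Finset.sum_singleton, if_true, Bool.false_eq_true, if_false,
    add_sub_cancel, Finset.prod_const_one] using this.symm

lemma inputVector_injective (hlam : lam0 < lam1) : Function.Injective (inputVector lam0 lam1) := by
  intro b c h
  ext j
  have := congrFun h j
  simp only [inputVector] at this
  cases hb : b j <;> cases hc : c j <;> simp [hb, hc, hlam.ne, hlam.ne'] at this ⊢

lemma XLaw_eq_sum (hp0 : 0 < p) (hp1 : p < 1) :
    XLaw p lam0 lam1 =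
      ∑ b, ENNReal.ofReal (inputWeight p b) • Measure.dirac (inputVector lam0 lam1 b) := by
  have : IsFiniteMeasure (inputLaw p lam0 lam1) := by
    unfold inputLaw
    constructor
    simp
  classical
  refine Measure.pi_eq fun s hs => ?_
  have hone : ∀ j, inputLaw p lam0 lam1 (s j) = ∑ c : Bool,
      ENNReal.ofReal (if c then p else 1 - p) *
        Measure.dirac (if c then lam1 else lam0) (s j) := fun j => by
    simp [inputLaw]
  simp only [hone, Finset.prod_univ_sum, Fintype.piFinset_univ, Measure.coe_finsetSum,
    Finset.sum_apply, Measure.smul_apply, smul_eq_mul, Finset.prod_mul_distrib]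
  refine Finset.sum_congr rfl fun b _ => ?_
  congr 1
  · rw [inputWeight, ENNReal.ofReal_prod_of_nonneg fun j _ => by split_ifs <;> linarith]
  · rw [Measure.dirac_apply' _ (MeasurableSet.univ_pi hs)]
    simp only [Measure.dirac_apply' _ (hs _), Set.indicator_apply, Set.mem_univ_pi, inputVector,
      Pi.one_apply, Finset.prod_boole, Finset.mem_univ, true_implies]

lemma sum_smul_dirac_bind {ι S Ω : Type*} [Fintype ι] [MeasurableSpace S]
    [MeasurableSingletonClass S] [MeasurableSpace Ω] (c : ι → ℝ≥0∞) (φ : ι → S)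
    (K : S → Measure Ω) :
    (∑ b, c b • Measure.dirac (φ b)).bind K = ∑ b, c b • K (φ b) := by
  have hK : AEMeasurable K (∑ b, c b • Measure.dirac (φ b)) := by
    rw [← Measure.sum_fintype, aemeasurable_sum_measure_iff]
    exact fun b => aemeasurable_dirac.smul_measure _
  ext s hs
  rw [Measure.bind_apply hs hK]
  simp [lintegral_finsetSum_measure]

lemma poissonJointLaw_eq_mixtureLaw (hp0 : 0 < p) (hp1 : p < 1) {T : Fin 15 → ℝ} {k : ℕ}
    {idx : Fin k → Fin 15} :
    poissonJointLaw p lam0 lam1 T idx =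
      mixtureLaw (inputWeight p) (inputVector lam0 lam1) fun b => Measure.pi fun i =>
        _root_.poissonMeasure (T (idx i) * ∑ j ∈ sens (idx i), inputVector lam0 lam1 b j) := by
  rw [poissonJointLaw, XLaw_eq_sum hp0 hp1, sum_smul_dirac_bind, mixtureLaw]

lemma measureMutualInfo_poissonJointLaw (hlam0 : 0 ≤ lam0) (hlam : lam0 < lam1) (hp0 : 0 < p)
    (hp1 : p < 1) {T : Fin 15 → ℝ} {k : ℕ} {idx : Fin k → Fin 15} {t : ℝ} (ht : 0 ≤ t)
    (hT : ∀ i, T (idx i) = t) :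
    measureMutualInfo (poissonJointLaw p lam0 lam1 T idx) =
      (massEntropy (inputWeight p)).toReal - (condEntropy (inputWeight p)
        (fun b i => ∑ j ∈ sens (idx i), inputVector lam0 lam1 b j) t).toReal := by
  have hr : ∀ b i, 0 ≤ ∑ j ∈ sens (idx i), inputVector lam0 lam1 b j := fun b i =>
    Finset.sum_nonneg fun j _ => by
      rw [inputVector]
      split_ifs <;> linarith
  have hreal : ∀ b y, (Measure.pi fun i =>
      _root_.poissonMeasure (t * ∑ j ∈ sens (idx i), inputVector lam0 lam1 b j)).real {y} =
        poissonWeight t (fun i => ∑ j ∈ sens (idx i), inputVector lam0 lam1 b j) y := fun b y => by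
    rw [measureReal_def, pi_poissonMeasure_singleton ht (hr b),
      ENNReal.toReal_ofReal (poissonWeight_nonneg ht (hr b) y)]
  rw [poissonJointLaw_eq_mixtureLaw hp0 hp1]
  simp only [hT]
  rw [measureMutualInfo_mixtureLaw (inputWeight_nonneg hp0 hp1) sum_inputWeight
    (inputVector_injective hlam)]
  · simp only [hreal, condEntropy]
  · intro b
    simp only [hreal]
    exact (summable_prod_and_negMulLog_prod _ (fun i => summable_poisson _)
      fun i => summable_negMulLog_poisson (mul_nonneg ht (hr b i))).2

end JointLaw

/-- `T ↦ I(X₁,…,X₄; Y₅,…,Y₁₀)` with `T₅ = ⋯ = T₁₀ = T/6` and all other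
times `0` is concave on `[0,∞)`. -/
theorem poisson_mutualInfo_pairs_concave
    (p lam0 lam1 : ℝ) (hlam0 : 0 ≤ lam0) (hlam : lam0 < lam1) (hp0 : 0 < p) (hp1 : p < 1) :
    ConcaveOn ℝ (Set.Ici (0 : ℝ)) (fun T : ℝ =>
      measureMutualInfo (poissonJointLaw p lam0 lam1
        (fun i => if 4 ≤ i.val ∧ i.val ≤ 9 then T / 6 else 0)
        (fun i : Fin 6 => (⟨i.val + 4, by omega⟩ : Fin 15)))) := by
  have hconv := convexOn_condEntropy (v := inputWeight p)
    (r := fun b (i : Fin 6) => ∑ j ∈ sens ⟨i.val + 4, by omega⟩, inputVector lam0 lam1 b j)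
    (inputWeight_nonneg hp0 hp1) fun b i => Finset.sum_nonneg fun j _ => by
      rw [inputVector]
      split_ifs <;> linarith
  have hscale := hconv.comp_linearMap ((1 / 6 : ℝ) • LinearMap.id)
  refine (((concaveOn_const (massEntropy (inputWeight p)).toReal (convex_Ici 0)).sub
    (hscale.subset (fun T hT => ?_) (convex_Ici 0)))).congr fun T hT => ?_
  · simpa using hT
  · have hT6 : 0 ≤ T / 6 := div_nonneg hT (by norm_num)
    rw [measureMutualInfo_poissonJointLaw hlam0 hlam hp0 hp1 hT6 fun i => if_pos (by
      have := i.isLt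
      simp only
      omega)]
    simp [div_eq_inv_mul]
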